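/- Let ⟨−,−⟩: H ⊗ K → k be a dual pairing of Hopf algebras over a field k, C a k-coalgebra, A a unital k-algebra, and (−,−): A ⊗ C → k a non-degenerate dual pairing. Assume A is a symmetric left partial K-comodule algebra with coaction λ(a) = a⁽⁻¹⁾ ⊗ a⁽⁰⁾, and suppose ·: H ⊗ C → C is a linear map satisfying (a, h·c) = ⟨h, a⁽⁻¹⁾⟩(a⁽⁰⁾, c) for all a ∈ A, c ∈ C, h ∈ H. Then · makes C a symmetric left partial H-module coalgebra. -/

import Mathlib

open TensorProduct

/-- `sw2 k f g` is the Sweedler-style map `h ↦ ∑ f(h₍₁₎) * g(h₍₂₎)`. -/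
noncomputable def sw2 (k : Type*) [Field k] {H A : Type*}
    [AddCommGroup H] [Module k H] [Coalgebra k H]
    [Ring A] [Algebra k A] (f g : H →ₗ[k] A) : H →ₗ[k] A :=
  TensorProduct.lift ((LinearMap.mul k A).compl₁₂ f g) ∘ₗ Coalgebra.comul
/-- `sw4 k f₁ f₂ h c = ∑ f₁(h₍₁₎ ⊗ c₍₁₎) ⊗ f₂(h₍₂₎ ⊗ c₍₂₎)` in Sweedler notation. -/
noncomputable def sw4 (k : Type*) [Field k] {H C M N : Type*}
    [AddCommGroup H] [Module k H] [Coalgebra k H]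
    [AddCommGroup C] [Module k C] [Coalgebra k C]
    [AddCommGroup M] [Module k M] [AddCommGroup N] [Module k N]
    (f₁ : H ⊗[k] C →ₗ[k] M) (f₂ : H ⊗[k] C →ₗ[k] N) (h : H) (c : C) : M ⊗[k] N :=
  (TensorProduct.map f₁ f₂)
    ((TensorProduct.tensorTensorTensorComm k H H C C)
      ((Coalgebra.comul (R := k) h) ⊗ₜ[k] (Coalgebra.comul (R := k) c)))
/-- A dual pairing of Hopf algebras `⟨-,-⟩ : H ⊗ K → k`:
`⟨hh',x⟩ = ∑ ⟨h,x₍₁₎⟩⟨h',x₍₂₎⟩`, `⟨1,x⟩ = ε(x)`, `⟨h,xy⟩ = ∑ ⟨h₍₁₎,x⟩⟨h₍₂₎,y⟩`, `⟨h,1⟩ = ε(h)`. -/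
structure IsHopfPairing (k : Type*) [Field k] {H K : Type*} [Ring H] [HopfAlgebra k H]
    [Ring K] [HopfAlgebra k K] (p : H →ₗ[k] K →ₗ[k] k) : Prop where
  mul_left : ∀ (h h' : H) (x : K), p (h * h') x = sw2 k (p h) (p h') x
  one_left : ∀ x : K, p 1 x = Coalgebra.counit x
  mul_right : ∀ (h : H) (x y : K), p h (x * y) = sw2 k (p.flip x) (p.flip y) h
  one_right : ∀ h : H, p h 1 = Coalgebra.counit h
/-- A left partial `H`-module coalgebra: (PLHMC1) `Δ(h·c) = ∑ (h₍₁₎·c₍₁₎) ⊗ (h₍₂₎·c₍₂₎)`;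
(PLHMC2) `1·c = c`; (PLHMC3) `h·(g·c) = ∑ (hg₍₁₎·c₍₁₎) ε(g₍₂₎·c₍₂₎)`. -/
structure IsPartialModuleCoalgebra (k : Type*) [Field k] {H C : Type*} [Ring H] [Bialgebra k H]
    [AddCommGroup C] [Module k C] [Coalgebra k C] (act : H →ₗ[k] C →ₗ[k] C) : Prop where
  plhmc1 : ∀ (h : H) (c : C), Coalgebra.comul (R := k) (act h c) =
    sw4 k (TensorProduct.lift act) (TensorProduct.lift act) h c
  plhmc2 : ∀ c : C, act 1 c = c
  plhmc3 : ∀ (h g : H) (c : C), act h (act g c) =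
    (TensorProduct.rid k C) (sw4 k
      (TensorProduct.lift act ∘ₗ TensorProduct.map (LinearMap.mulLeft k h) LinearMap.id)
      (Coalgebra.counit ∘ₗ TensorProduct.lift act) g c)
/-- A symmetric left partial `H`-module coalgebra: a left partial `H`-module coalgebra
which moreover satisfies (PLHMC3') `h·(g·c) = ∑ ε(g₍₁₎·c₍₁₎) (hg₍₂₎·c₍₂₎)`. -/
structure IsSymmPartialModuleCoalgebra (k : Type*) [Field k] {H C : Type*}
    [Ring H] [Bialgebra k H] [AddCommGroup C] [Module k C] [Coalgebra k C]
    (act : H →ₗ[k] C →ₗ[k] C) extends IsPartialModuleCoalgebra k act : Prop where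
  plhmc3' : ∀ (h g : H) (c : C), act h (act g c) =
    (TensorProduct.lid k C) (sw4 k
      (Coalgebra.counit ∘ₗ TensorProduct.lift act)
      (TensorProduct.lift act ∘ₗ TensorProduct.map (LinearMap.mulLeft k h) LinearMap.id) g c)
/-- A dual pairing `(-,-) : A ⊗ C → k` between a unital algebra `A` and a coalgebra `C`:
`(ab,c) = ∑ (a,c₍₁₎)(b,c₍₂₎)` and `(1,c) = ε(c)`. -/
structure IsAlgCoalgPairing (k : Type*) [Field k] {A C : Type*} [Ring A] [Algebra k A]
    [AddCommGroup C] [Module k C] [Coalgebra k C] (q : A →ₗ[k] C →ₗ[k] k) : Prop where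
  pair_mul : ∀ (a b : A) (c : C), q (a * b) c =
    (TensorProduct.lid k k) (TensorProduct.map (q a) (q b) (Coalgebra.comul (R := k) c))
  pair_one : ∀ c : C, q 1 c = Coalgebra.counit c
/-- A symmetric left partial coaction of a Hopf algebra `K` on a unital algebra `A`:
`λ(ab) = λ(a)λ(b)`; `(ε ⊗ id)λ(a) = a`;
`(id ⊗ λ)λ(a) = (1_K ⊗ λ(1))[(Δ ⊗ id)λ(a)]` and `(id ⊗ λ)λ(a) = [(Δ ⊗ id)λ(a)](1_K ⊗ λ(1))`. -/
structure IsSymmLeftPartialCoaction (k : Type*) [Field k] {K A : Type*}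
    [Ring K] [HopfAlgebra k K] [Ring A] [Algebra k A] (lam : A →ₗ[k] K ⊗[k] A) : Prop where
  plca1 : ∀ a b : A, lam (a * b) = lam a * lam b
  plca2 : ∀ a : A,
    (TensorProduct.lid k A) ((TensorProduct.map Coalgebra.counit LinearMap.id) (lam a)) = a
  plca3 : ∀ a : A, (TensorProduct.map LinearMap.id lam) (lam a) =
    ((1 : K) ⊗ₜ[k] lam 1) * ((TensorProduct.assoc k K K A)
      ((TensorProduct.map (Coalgebra.comul (R := k)) LinearMap.id) (lam a)))
  plca3' : ∀ a : A, (TensorProduct.map LinearMap.id lam) (lam a) =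
    ((TensorProduct.assoc k K K A)
      ((TensorProduct.map (Coalgebra.comul (R := k)) LinearMap.id) (lam a))) * ((1 : K) ⊗ₜ[k] lam 1)

/-- The functional `h ⊗ c ↦ ⟨h, x₁⟩(x₂, c)` on `H ⊗ C` attached to `x = ∑ x₁ ⊗ x₂` in `K ⊗ A`. -/
noncomputable def tensorPairing {k H K A C : Type*} [Field k]
    [AddCommGroup H] [Module k H] [AddCommGroup K] [Module k K]
    [AddCommGroup A] [Module k A] [AddCommGroup C] [Module k C]
    (p : H →ₗ[k] K →ₗ[k] k) (q : A →ₗ[k] C →ₗ[k] k) : K ⊗[k] A →ₗ[k] H ⊗[k] C →ₗ[k] k :=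
  (LinearMap.compRight k (TensorProduct.lid k k).toLinearMap ∘ₗ
    TensorProduct.homTensorHomMap (.id k) H C k k) ∘ₗ
      TensorProduct.map p.flip q

section Linear

variable {k H K A C : Type*} [Field k]
  [AddCommGroup H] [Module k H] [AddCommGroup K] [Module k K]
  [AddCommGroup A] [Module k A] [AddCommGroup C] [Module k C]

@[simp]
theorem tensorPairing_tmul_tmul (p : H →ₗ[k] K →ₗ[k] k) (q : A →ₗ[k] C →ₗ[k] k)
    (x : K) (a : A) (h : H) (c : C) :
    tensorPairing p q (x ⊗ₜ a) (h ⊗ₜ c) = p h x * q a c := by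
  simp [tensorPairing]

theorem tensorPairing_apply_tmul (p : H →ₗ[k] K →ₗ[k] k) (q : A →ₗ[k] C →ₗ[k] k)
    (z : K ⊗[k] A) (h : H) (c : C) :
    tensorPairing p q z (h ⊗ₜ c) =
      TensorProduct.lid k k (TensorProduct.map (p h) (q.flip c) z) := by
  induction z with
  | zero => simp
  | tmul x a => simp
  | add z w hz hw => simp [hz, hw]

/-- A family of functionals separating the points of `C` also separates those of `C ⊗ C`. -/
theorem tensor_eq_of_forall_pairing_eq (q : A →ₗ[k] C →ₗ[k] k)
    (hq : ∀ c : C, (∀ a : A, q a c = 0) → c = 0) {s t : C ⊗[k] C}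
    (hst : ∀ a b : A, TensorProduct.map (q a) (q b) s = TensorProduct.map (q a) (q b) t) :
    s = t := by
  classical
  let ℬ := Module.Basis.ofVectorSpace k C
  have hleft : ∀ a : A, TensorProduct.lid k C ((q a).rTensor C s) =
      TensorProduct.lid k C ((q a).rTensor C t) := by
    intro a
    rw [← sub_eq_zero]
    refine hq _ fun b => ?_
    have key : ∀ u : C ⊗[k] C, q b (TensorProduct.lid k C ((q a).rTensor C u)) =
        TensorProduct.lid k k (TensorProduct.map (q a) (q b) u) := by
      intro u
      induction u with
      | zero => simp
      | tmul c d => simp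
      | add u v hu hv => simp only [map_add, hu, hv]
    rw [map_sub, key, key, hst, sub_self]
  apply (TensorProduct.equivFinsuppOfBasisRight (M := C) ℬ).injective
  ext i
  rw [← sub_eq_zero]
  refine hq _ fun a => ?_
  have key : ∀ u : C ⊗[k] C, q a (TensorProduct.equivFinsuppOfBasisRight (M := C) ℬ u i) =
      ℬ.repr (TensorProduct.lid k C ((q a).rTensor C u)) i := by
    intro u
    induction u with
    | zero => simp
    | tmul c d => simp [mul_comm]
    | add u v hu hv => simp only [map_add, Finsupp.add_apply, hu, hv]
  rw [map_sub, key, key, hleft, sub_self]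

/-- Naturality of `sw4` in its two maps. -/
theorem map_sw4 [Coalgebra k H] [Coalgebra k C] {M N M' N' : Type*}
    [AddCommGroup M] [Module k M] [AddCommGroup N] [Module k N]
    [AddCommGroup M'] [Module k M'] [AddCommGroup N'] [Module k N']
    (u : M →ₗ[k] M') (v : N →ₗ[k] N') (f : H ⊗[k] C →ₗ[k] M) (g : H ⊗[k] C →ₗ[k] N)
    (h : H) (c : C) :
    TensorProduct.map u v (sw4 k f g h c) = sw4 k (u ∘ₗ f) (v ∘ₗ g) h c := by
  simp only [sw4, TensorProduct.map_comp, LinearMap.comp_apply]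

theorem apply_lid (f : C →ₗ[k] k) (t : k ⊗[k] C) :
    f (TensorProduct.lid k C t) =
      TensorProduct.lid k k (TensorProduct.map LinearMap.id f t) := by
  induction t with
  | zero => simp
  | tmul r c => simp
  | add t u ht hu => simp only [map_add, ht, hu]

theorem apply_rid (f : C →ₗ[k] k) (t : C ⊗[k] k) :
    f (TensorProduct.rid k C t) =
      TensorProduct.lid k k (TensorProduct.map f LinearMap.id t) := by
  induction t with
  | zero => simp
  | tmul c r => simp [mul_comm]
  | add t u ht hu => simp only [map_add, ht, hu]

/-- Pairing the first tensor factor with `h`: the map `x ⊗ m ↦ ⟨h, x⟩ m`. -/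
noncomputable def pairLeft (p : H →ₗ[k] K →ₗ[k] k) (h : H) (M : Type*)
    [AddCommGroup M] [Module k M] : K ⊗[k] M →ₗ[k] M :=
  (TensorProduct.lid k M).toLinearMap ∘ₗ (p h).rTensor M

@[simp]
theorem pairLeft_tmul (p : H →ₗ[k] K →ₗ[k] k) (h : H) {M : Type*}
    [AddCommGroup M] [Module k M] (x : K) (m : M) :
    pairLeft p h M (x ⊗ₜ m) = p h x • m := by
  simp [pairLeft]

theorem tensorPairing_tmul_act (p : H →ₗ[k] K →ₗ[k] k) (q : A →ₗ[k] C →ₗ[k] k)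
    (lam : A →ₗ[k] K ⊗[k] A) (lact : H →ₗ[k] C →ₗ[k] C)
    (hcompat : ∀ a : A, q a ∘ₗ TensorProduct.lift lact = tensorPairing p q (lam a))
    (z : K ⊗[k] A) (h g : H) (c : C) :
    tensorPairing p q z (h ⊗ₜ lact g c) =
      tensorPairing p q (pairLeft p h _ (TensorProduct.map LinearMap.id lam z)) (g ⊗ₜ c) := by
  induction z with
  | zero => simp
  | tmul x a => simp [← hcompat]
  | add z w hz hw => simp only [map_add, LinearMap.add_apply, hz, hw]

end Linear

section Algebra

variable {k H K A C : Type*} [Field k] [Ring H] [HopfAlgebra k H] [Ring K] [HopfAlgebra k K]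
  [Ring A] [Algebra k A]

theorem pairLeft_one_tmul_mul (p : H →ₗ[k] K →ₗ[k] k) (h : H) {B : Type*} [Ring B]
    [Algebra k B] (y : B) (z : K ⊗[k] B) :
    pairLeft p h B ((1 ⊗ₜ y) * z) = y * pairLeft p h B z := by
  induction z with
  | zero => simp
  | tmul x b => simp
  | add z w hz hw => simp only [mul_add, map_add, hz, hw]

theorem pairLeft_mul_one_tmul (p : H →ₗ[k] K →ₗ[k] k) (h : H) {B : Type*} [Ring B]
    [Algebra k B] (y : B) (z : K ⊗[k] B) :
    pairLeft p h B (z * (1 ⊗ₜ y)) = pairLeft p h B z * y := by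
  induction z with
  | zero => simp
  | tmul x b => simp
  | add z w hz hw => simp only [add_mul, map_add, hz, hw]

theorem tensorPairing_pairLeft_comul [AddCommGroup C] [Module k C]
    {p : H →ₗ[k] K →ₗ[k] k} (hp : IsHopfPairing k p) (q : A →ₗ[k] C →ₗ[k] k)
    (z : K ⊗[k] A) (h : H) :
    tensorPairing p q (pairLeft p h _ (TensorProduct.assoc k K K A
      (TensorProduct.map (Coalgebra.comul (R := k)) LinearMap.id z))) =
      tensorPairing p q z ∘ₗ TensorProduct.map (LinearMap.mulLeft k h) LinearMap.id := by
  induction z with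
  | zero => simp
  | add z w hz hw => simp only [map_add, hz, hw, LinearMap.add_comp]
  | tmul x a =>
    ext g c
    have key : ∀ w : K ⊗[k] K, tensorPairing p q (pairLeft p h _
        (TensorProduct.assoc k K K A (w ⊗ₜ a))) (g ⊗ₜ c) =
        TensorProduct.lift ((LinearMap.mul k k).compl₁₂ (p h) (p g)) w * q a c := by
      intro w
      induction w with
      | zero => simp
      | tmul x y => simp [mul_assoc]
      | add w v hw hv => simp only [TensorProduct.add_tmul, map_add, LinearMap.add_apply, hw, hv,
          add_mul]
    simp [key, hp.mul_left, sw2]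

variable [AddCommGroup C] [Module k C]

theorem tensorPairing_one_tmul {p : H →ₗ[k] K →ₗ[k] k} (hp : IsHopfPairing k p)
    (q : A →ₗ[k] C →ₗ[k] k) (z : K ⊗[k] A) (c : C) :
    tensorPairing p q z (1 ⊗ₜ c) =
      q (TensorProduct.lid k A (TensorProduct.map Coalgebra.counit LinearMap.id z)) c := by
  induction z with
  | zero => simp
  | tmul x a => simp [hp.one_left]
  | add z w hz hw => simp only [map_add, LinearMap.add_apply, hz, hw]

variable [Coalgebra k C]

theorem tensorPairing_mul {p : H →ₗ[k] K →ₗ[k] k} (hp : IsHopfPairing k p)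
    {q : A →ₗ[k] C →ₗ[k] k} (hq : IsAlgCoalgPairing k q) (z w : K ⊗[k] A) (h : H) (c : C) :
    tensorPairing p q (z * w) (h ⊗ₜ c) =
      TensorProduct.lid k k (sw4 k (tensorPairing p q z) (tensorPairing p q w) h c) := by
  induction z with
  | zero => simp [sw4]
  | add z z' hz hz' =>
    simp only [add_mul, map_add, LinearMap.add_apply, hz, hz', sw4, TensorProduct.map_add_left]
  | tmul x a =>
    induction w with
    | zero => simp [sw4]
    | add w w' hw hw' =>
      simp only [mul_add, map_add, LinearMap.add_apply, hw, hw', sw4, TensorProduct.map_add_right]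
    | tmul y b =>
      have key : ∀ (u : H ⊗[k] H) (v : C ⊗[k] C),
          TensorProduct.lift ((LinearMap.mul k k).compl₁₂ (p.flip x) (p.flip y)) u *
            TensorProduct.lid k k (TensorProduct.map (q a) (q b) v) =
          TensorProduct.lid k k (TensorProduct.map (tensorPairing p q (x ⊗ₜ a))
            (tensorPairing p q (y ⊗ₜ b))
            (TensorProduct.tensorTensorTensorComm k H H C C (u ⊗ₜ v))) := by
        intro u v
        induction u with
        | zero => simp
        | add u u' hu hu' => simp only [TensorProduct.add_tmul, map_add, add_mul, hu, hu']
        | tmul h h' =>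
          induction v with
          | zero => simp
          | add v v' hv hv' => simp only [TensorProduct.tmul_add, map_add, mul_add, hv, hv']
          | tmul c c' => simp [mul_mul_mul_comm]
      rw [sw4, ← key, Algebra.TensorProduct.tmul_mul_tmul, tensorPairing_tmul_tmul, hp.mul_right,
        hq.pair_mul, sw2, LinearMap.comp_apply]

end Algebra

/-- Let `⟨-,-⟩ : H ⊗ K → k` be a dual pairing of Hopf algebras, `(-,-) : A ⊗ C → k` a
non-degenerate dual pairing between a unital algebra `A` and a coalgebra `C`, and let `A` be a
symmetric left partial `K`-comodule algebra with coaction `λ(a) = a⁽⁻¹⁾ ⊗ a⁽⁰⁾`. If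
`· : H ⊗ C → C` is a linear map satisfying `(a, h·c) = ⟨h, a⁽⁻¹⁾⟩(a⁽⁰⁾, c)`, then `·` makes
`C` a symmetric left partial `H`-module coalgebra. -/
theorem leftPartialComoduleAlgebra_to_partialModuleCoalgebra
    {k H K A C : Type*} [Field k] [Ring H] [HopfAlgebra k H] [Ring K] [HopfAlgebra k K]
    [Ring A] [Algebra k A] [AddCommGroup C] [Module k C] [Coalgebra k C]
    (p : H →ₗ[k] K →ₗ[k] k) (hp : IsHopfPairing k p)
    (q : A →ₗ[k] C →ₗ[k] k) (hq : IsAlgCoalgPairing k q)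
    (hnd₁ : ∀ a : A, (∀ c : C, q a c = 0) → a = 0)
    (hnd₂ : ∀ c : C, (∀ a : A, q a c = 0) → c = 0)
    (lam : A →ₗ[k] K ⊗[k] A) (hlam : IsSymmLeftPartialCoaction k lam)
    (lact : H →ₗ[k] C →ₗ[k] C)
    (hcompat : ∀ (a : A) (h : H) (c : C), q a (lact h c) =
      (TensorProduct.lid k k) ((TensorProduct.map (p h) (q.flip c)) (lam a))) :
    IsSymmPartialModuleCoalgebra k lact := by
  have hact (a : A) : q a ∘ₗ TensorProduct.lift lact = tensorPairing p q (lam a) := by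
    ext h c
    simpa [tensorPairing_apply_tmul] using hcompat a h c
  have hact_apply (a : A) (h : H) (c : C) :
      q a (lact h c) = tensorPairing p q (lam a) (h ⊗ₜ c) := by
    simp [← hact]
  have hcounit : Coalgebra.counit ∘ₗ TensorProduct.lift lact = tensorPairing p q (lam 1) := by
    rw [← hact, show q 1 = Coalgebra.counit from LinearMap.ext hq.pair_one]
  have hsep {c d : C} (hcd : ∀ a, q a c = q a d) : c = d :=
    sub_eq_zero.mp (hnd₂ _ fun a => by rw [map_sub, hcd, sub_self])
  refine ⟨⟨fun h c => ?_, fun c => ?_, fun h g c => ?_⟩, fun h g c => ?_⟩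
  · refine tensor_eq_of_forall_pairing_eq q hnd₂ fun a b => ?_
    apply (TensorProduct.lid k k).injective
    rw [← hq.pair_mul, hact_apply, hlam.plca1, tensorPairing_mul hp hq, map_sw4, hact, hact]
  · refine hsep fun a => ?_
    rw [hact_apply, tensorPairing_one_tmul hp, hlam.plca2]
  · refine hsep fun a => ?_
    rw [hact_apply, tensorPairing_tmul_act p q lam lact hact, hlam.plca3',
      pairLeft_mul_one_tmul, tensorPairing_mul hp hq, tensorPairing_pairLeft_comul hp,
      apply_rid, map_sw4, ← LinearMap.comp_assoc, hact, hcounit, LinearMap.id_comp]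
  · refine hsep fun a => ?_
    rw [hact_apply, tensorPairing_tmul_act p q lam lact hact, hlam.plca3,
      pairLeft_one_tmul_mul, tensorPairing_mul hp hq, tensorPairing_pairLeft_comul hp,
      apply_lid, map_sw4, LinearMap.id_comp, hcounit, ← LinearMap.comp_assoc, hact]
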